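/- arXiv:2301.03080 — 6 statements merged into one kernel-verified Lean document; each statement's English description precedes it below -/
import Mathlib

section
/- Let X be a measurable space, κ ∈ (0,1], and g : X → ℝ a measurable function with κ ≤ g(x) ≤ κ⁻¹ for all x ∈ X. Then for any two probability measures μ and ν on X, d(L_g μ, L_g ν) ≤ 2κ⁻²·d(μ, ν). -/
open MeasureTheory ProbabilityTheory

/-- Total-variation distance between two measures:
`d(μ,ν) = (1/2)·sup{ |∫ f dμ − ∫ f dν| : f measurable, sup|f| ≤ 1 }`. -/
noncomputable def tvDist {X : Type*} [MeasurableSpace X] (μ ν : Measure X) : ℝ :=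
  sSup {r : ℝ | ∃ f : X → ℝ, Measurable f ∧ (∀ x, |f x| ≤ 1) ∧
    r = (1 / 2) * |(∫ x, f x ∂μ) - ∫ x, f x ∂ν|}

/-- The likelihood operator `(L_g μ)(A) = (∫_A g dμ)/(∫_X g dμ)`. -/
noncomputable def likelihoodOp {X : Type*} [MeasurableSpace X] (g : X → ℝ) (μ : Measure X) :
    Measure X :=
  ((μ.withDensity fun x => ENNReal.ofReal (g x)) Set.univ)⁻¹ •
    μ.withDensity fun x => ENNReal.ofReal (g x)

/-- If `κ ≤ g ≤ κ⁻¹` with `κ ∈ (0,1]`, then the likelihood operator `L_g`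
is `2κ⁻²`-Lipschitz in the total-variation distance. -/
theorem likelihood_operator_lipschitz_tv
    {X : Type*} [MeasurableSpace X] (κ : ℝ) (hκ : κ ∈ Set.Ioc (0 : ℝ) 1)
    (g : X → ℝ) (hg : Measurable g) (hgb : ∀ x, κ ≤ g x ∧ g x ≤ κ⁻¹)
    (μ ν : Measure X) [IsProbabilityMeasure μ] [IsProbabilityMeasure ν] :
    tvDist (likelihoodOp g μ) (likelihoodOp g ν) ≤ 2 * κ⁻¹ ^ 2 * tvDist μ ν := by
  obtain ⟨hκ0, hκ1⟩ := hκ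
  have hg0 : ∀ x, 0 ≤ g x := fun x => hκ0.le.trans (hgb x).1
  -- bound on the test functionals by the distance
  have key : ∀ h : X → ℝ, Measurable h → (∀ x, |h x| ≤ κ⁻¹) →
      (1 / 2) * |(∫ x, h x ∂μ) - ∫ x, h x ∂ν| ≤ κ⁻¹ * tvDist μ ν := by
    intro h hm hb
    have hbdd : BddAbove {r : ℝ | ∃ f : X → ℝ, Measurable f ∧ (∀ x, |f x| ≤ 1) ∧
        r = (1 / 2) * |(∫ x, f x ∂μ) - ∫ x, f x ∂ν|} := by
      refine ⟨1, ?_⟩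
      rintro r ⟨f, -, hf1, rfl⟩
      have h1 : ‖∫ x, f x ∂μ‖ ≤ 1 * μ.real Set.univ :=
        norm_integral_le_of_norm_le_const (Filter.Eventually.of_forall hf1)
      have h2 : ‖∫ x, f x ∂ν‖ ≤ 1 * ν.real Set.univ :=
        norm_integral_le_of_norm_le_const (Filter.Eventually.of_forall hf1)
      simp only [probReal_univ, Real.norm_eq_abs, mul_one] at h1 h2
      have := abs_sub (∫ x, f x ∂μ) (∫ x, f x ∂ν)
      linarith
    have hle : (1 / 2) * |(∫ x, κ * h x ∂μ) - ∫ x, κ * h x ∂ν| ≤ tvDist μ ν := by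
      refine le_csSup hbdd ⟨fun x => κ * h x, hm.const_mul κ, fun x => ?_, rfl⟩
      rw [abs_mul, abs_of_pos hκ0]
      calc κ * |h x| ≤ κ * κ⁻¹ := by gcongr; exact hb x
        _ = 1 := mul_inv_cancel₀ hκ0.ne'
    rw [integral_const_mul, integral_const_mul, ← mul_sub, abs_mul, abs_of_pos hκ0] at hle
    rw [inv_mul_eq_div, le_div_iff₀ hκ0]
    linarith
  have hgi : ∀ (ρ : Measure X) [IsProbabilityMeasure ρ], Integrable g ρ := fun ρ _ =>
    Integrable.of_bound hg.aestronglyMeasurable κ⁻¹ (Filter.Eventually.of_forall fun x => by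
      rw [Real.norm_eq_abs, abs_of_nonneg (hg0 x)]; exact (hgb x).2)
  have hpos : ∀ (ρ : Measure X) [IsProbabilityMeasure ρ], κ ≤ ∫ x, g x ∂ρ := fun ρ _ => by
    have := integral_mono (integrable_const κ) (hgi ρ) (fun x => (hgb x).1)
    simpa using this
  have hint : ∀ (ρ : Measure X) [IsProbabilityMeasure ρ] (f : X → ℝ),
      ∫ x, f x ∂(likelihoodOp g ρ) = (∫ x, g x * f x ∂ρ) / ∫ x, g x ∂ρ := by
    intro ρ _ f
    unfold likelihoodOp
    rw [integral_smul_measure, withDensity_apply _ MeasurableSet.univ, Measure.restrict_univ,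
      integral_withDensity_eq_integral_toReal_smul hg.ennreal_ofReal
        (Filter.Eventually.of_forall fun x => ENNReal.ofReal_lt_top),
      ← ofReal_integral_eq_lintegral_ofReal (hgi ρ) (Filter.Eventually.of_forall hg0),
      ENNReal.toReal_inv, ENNReal.toReal_ofReal (hκ0.le.trans (hpos ρ))]
    simp only [ENNReal.toReal_ofReal (hg0 _), smul_eq_mul]
    rw [inv_mul_eq_div]
  unfold tvDist
  refine csSup_le ⟨_, fun _ => 0, measurable_const, fun _ => by simp, rfl⟩ ?_
  rintro r ⟨f, hf, hf1, rfl⟩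
  change _ ≤ 2 * κ⁻¹ ^ 2 * tvDist μ ν
  rw [hint, hint]
  have hgf : ∀ x, |g x * f x| ≤ g x := fun x => by
    rw [abs_mul, abs_of_nonneg (hg0 x)]
    exact mul_le_of_le_one_right (hg0 x) (hf1 x)
  have k1 := key (fun x => g x * f x) (hg.mul hf) fun x => (hgf x).trans (hgb x).2
  have k2 := key g hg fun x => by rw [abs_of_nonneg (hg0 x)]; exact (hgb x).2
  have hc : |∫ x, g x * f x ∂ν| ≤ ∫ x, g x ∂ν :=
    norm_integral_le_of_norm_le (f := fun x => g x * f x) (hgi ν)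
      (Filter.Eventually.of_forall hgf)
  have hb := hpos μ
  have hd := hpos ν
  generalize (∫ x, g x * f x ∂μ) = a at *
  generalize (∫ x, g x * f x ∂ν) = c at *
  generalize (∫ x, g x ∂μ) = b at *
  generalize (∫ x, g x ∂ν) = d at *
  have hb0 : 0 < b := hκ0.trans_le hb
  have hd0 : 0 < d := hκ0.trans_le hd
  have e : a / b - c / d = ((a - c) - c / d * (b - d)) / b := by
    field_simp
    ring
  have hcd : |c / d| ≤ 1 := by
    rw [abs_div, abs_of_pos hd0]; exact (div_le_one hd0).2 hc
  have h3 : |(a - c) - c / d * (b - d)| ≤ |a - c| + |b - d| := by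
    refine (abs_sub _ _).trans ?_
    rw [abs_mul]
    have := mul_le_of_le_one_left (abs_nonneg (b - d)) hcd
    linarith
  rw [e, abs_div, abs_of_pos hb0, div_eq_mul_inv]
  have hbi : b⁻¹ ≤ κ⁻¹ := inv_anti₀ hκ0 hb
  calc 1 / 2 * (|(a - c) - c / d * (b - d)| * b⁻¹)
      ≤ 1 / 2 * ((|a - c| + |b - d|) * κ⁻¹) := by gcongr
    _ = (1 / 2 * |a - c| + 1 / 2 * |b - d|) * κ⁻¹ := by ring
    _ ≤ (κ⁻¹ * tvDist μ ν + κ⁻¹ * tvDist μ ν) * κ⁻¹ := by gcongr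
    _ = _ := by ring
end

section
/- Let a > 0 and N ≥ 1. For every integrable function f on [0,1] belonging to the discrete Lipschitz cone C_a, the Ulam projection satisfies ‖f − π_N f‖_{L¹([0,1])} ≤ (e^{a/N} − 1)·‖f‖_{L¹([0,1])}. -/
open MeasureTheory

/-- The `i`-th Ulam box of the uniform partition of `[0,1]` into `N` pieces
(`i = 1,…,N`): `B_i = [(i−1)/N, i/N)` for `i < N` and `B_N = [(N−1)/N, 1]`. -/
def ulamBox (N i : ℕ) : Set ℝ :=
  if i = N then Set.Icc (((N : ℝ) - 1) / N) 1
  else Set.Ico (((i : ℝ) - 1) / N) ((i : ℝ) / N)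

/-- The Ulam projection `π_N f = Σ_{i=1}^N (N·∫_{B_i} f dx)·1_{B_i}` onto piecewise
constant functions with respect to the uniform partition of `[0,1]`. -/
noncomputable def ulamProj (N : ℕ) (f : ℝ → ℝ) : ℝ → ℝ := fun x =>
  ∑ i ∈ Finset.Icc 1 N, (ulamBox N i).indicator (fun _ => (N : ℝ) * ∫ y in ulamBox N i, f y) x

/-- The discrete Lipschitz cone `C_a`: strictly positive functions on `[0,1]` with
`φ(x) ≤ e^{a·|x−y|}·φ(y)` for all `x, y ∈ [0,1]`. -/
def lipCone (a : ℝ) (φ : ℝ → ℝ) : Prop :=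
  (∀ x ∈ Set.Icc (0 : ℝ) 1, 0 < φ x) ∧
    ∀ x ∈ Set.Icc (0 : ℝ) 1, ∀ y ∈ Set.Icc (0 : ℝ) 1,
      φ x ≤ Real.exp (a * |x - y|) * φ y

lemma ulamBox_meas (N i : ℕ) : MeasurableSet (ulamBox N i) := by
  unfold ulamBox; split_ifs
  · exact measurableSet_Icc
  · exact measurableSet_Ico

lemma ulamBox_vol (N i : ℕ) (hN : 1 ≤ N) : volume.real (ulamBox N i) = 1 / N := by
  have h0 : (0 : ℝ) < N := by exact_mod_cast hN
  unfold ulamBox; split_ifs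
  · rw [Real.volume_real_Icc_of_le]
    · field_simp; ring
    · rw [div_le_one h0]; linarith
  · rw [Real.volume_real_Ico_of_le]
    · field_simp; ring
    · gcongr; linarith

lemma ulamBox_bounds (N i : ℕ) (hN : 1 ≤ N) {x : ℝ} (hx : x ∈ ulamBox N i) :
    (i : ℝ) - 1 ≤ N * x ∧ N * x ≤ i ∧ (i ≠ N → N * x < i) := by
  have h0 : (0 : ℝ) < N := by exact_mod_cast hN
  unfold ulamBox at hx
  split_ifs at hx with h
  · obtain ⟨h1, h2⟩ := hx
    rw [div_le_iff₀ h0] at h1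
    subst h
    refine ⟨by linarith, by nlinarith, fun h => absurd rfl h⟩
  · obtain ⟨h1, h2⟩ := hx
    rw [div_le_iff₀ h0] at h1
    rw [lt_div_iff₀ h0] at h2
    exact ⟨by linarith, by linarith, fun _ => by linarith⟩

lemma ulamBox_unique (N i j : ℕ) (hN : 1 ≤ N) (hi : i ≤ N) (hj : j ≤ N) {x : ℝ}
    (hx : x ∈ ulamBox N i) (hy : x ∈ ulamBox N j) : i = j := by
  obtain ⟨a1, a2, a3⟩ := ulamBox_bounds N i hN hx
  obtain ⟨b1, b2, b3⟩ := ulamBox_bounds N j hN hy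
  rcases lt_trichotomy i j with h | h | h
  · have := a3 (by omega)
    have h' : (i : ℝ) + 1 ≤ j := by exact_mod_cast h
    linarith
  · exact h
  · have := b3 (by omega)
    have h' : (j : ℝ) + 1 ≤ i := by exact_mod_cast h
    linarith

lemma ulamBox_subset (N i : ℕ) (hN : 1 ≤ N) (h1 : 1 ≤ i) (hi : i ≤ N) :
    ulamBox N i ⊆ Set.Icc 0 1 := by
  intro x hx
  obtain ⟨a1, a2, -⟩ := ulamBox_bounds N i hN hx
  have h0 : (0 : ℝ) < N := by exact_mod_cast hN
  have h1' : (1 : ℝ) ≤ i := by exact_mod_cast h1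
  have h2' : (i : ℝ) ≤ N := by exact_mod_cast hi
  constructor
  · by_contra h
    push Not at h
    nlinarith
  · by_contra h
    push Not at h
    nlinarith

lemma ulamBox_exists (N : ℕ) (hN : 1 ≤ N) {x : ℝ} (hx : x ∈ Set.Icc (0 : ℝ) 1) :
    ∃ i, 1 ≤ i ∧ i ≤ N ∧ x ∈ ulamBox N i := by
  have h0 : (0 : ℝ) < N := by exact_mod_cast hN
  obtain ⟨hx0, hx1⟩ := hx
  by_cases h : ((N : ℝ) - 1) / N ≤ x
  · exact ⟨N, hN, le_rfl, by unfold ulamBox; rw [if_pos rfl]; exact ⟨h, hx1⟩⟩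
  · push Not at h
    rw [lt_div_iff₀ h0] at h
    have hp : 0 ≤ x * N := by positivity
    have f1 := Nat.floor_le hp
    have f2 := Nat.lt_floor_add_one (x * N)
    have f3 : ⌊x * N⌋₊ + 1 < N := by
      have : ((⌊x * N⌋₊ + 1 : ℕ) : ℝ) < N := by push_cast; linarith
      exact_mod_cast this
    refine ⟨⌊x * N⌋₊ + 1, by omega, by omega, ?_⟩
    unfold ulamBox
    rw [if_neg (by omega)]
    constructor
    · rw [div_le_iff₀ h0]; push_cast; linarith
    · rw [lt_div_iff₀ h0]; push_cast; linarith

lemma ulam_pointwise (a : ℝ) (ha : 0 < a) (N : ℕ) (hN : 1 ≤ N)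
    (f : ℝ → ℝ) (hf : IntegrableOn f (Set.Icc (0 : ℝ) 1)) (hfa : lipCone a f)
    {x : ℝ} (hx : x ∈ Set.Icc (0 : ℝ) 1) :
    |f x - ulamProj N f x| ≤ (Real.exp (a / N) - 1) * |f x| := by
  have h0 : (0 : ℝ) < N := by exact_mod_cast hN
  obtain ⟨i, hi1, hiN, hxi⟩ := ulamBox_exists N hN hx
  have hproj : ulamProj N f x = N * ∫ y in ulamBox N i, f y := by
    unfold ulamProj
    rw [Finset.sum_eq_single i]
    · rw [Set.indicator_of_mem hxi]
    · intro j hj hji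
      rw [Finset.mem_Icc] at hj
      exact Set.indicator_of_notMem
        (fun hxj => hji (ulamBox_unique N j i hN hj.2 hiN hxj hxi)) _
    · intro h
      exact absurd (Finset.mem_Icc.2 ⟨hi1, hiN⟩) h
  have hsub := ulamBox_subset N i hN hi1 hiN
  have hfi : IntegrableOn f (ulamBox N i) := hf.mono_set hsub
  have hm := ulamBox_meas N i
  have hv := ulamBox_vol N i hN
  have hfin : volume (ulamBox N i) ≠ ⊤ :=
    ((measure_mono hsub).trans_lt (by simp)).ne
  set E := Real.exp (a / N) with hE
  have hE1 : 1 ≤ E := Real.one_le_exp (by positivity)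
  have hpos := hfa.1 x hx
  have key : ∀ u ∈ ulamBox N i, ∀ v ∈ ulamBox N i, f u ≤ E * f v := by
    intro u hu v hv
    refine (hfa.2 u (hsub hu) v (hsub hv)).trans ?_
    have := hfa.1 v (hsub hv)
    gcongr
    rw [hE, div_eq_mul_inv]
    gcongr
    obtain ⟨a1, a2, -⟩ := ulamBox_bounds N i hN hu
    obtain ⟨b1, b2, -⟩ := ulamBox_bounds N i hN hv
    rw [← one_div, le_div_iff₀ h0, ← abs_of_pos h0, ← abs_mul, abs_le]
    constructor <;> linarith
  have hc : ∀ c : ℝ, ∫ _ in ulamBox N i, c = c / N := by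
    intro c
    rw [setIntegral_const, hv, smul_eq_mul]; ring
  have up : ∫ y in ulamBox N i, f y ≤ (E * f x) / N := by
    rw [← hc]
    exact setIntegral_mono_on hfi (integrableOn_const hfin) hm fun y hy => key y hy x hxi
  have lo : f x / N ≤ E * ∫ y in ulamBox N i, f y := by
    rw [← hc, ← integral_const_mul]
    exact setIntegral_mono_on (integrableOn_const hfin) (hfi.const_mul E) hm
      fun y hy => key x hxi y hy
  rw [hproj, abs_of_pos hpos]
  rw [le_div_iff₀ h0] at up
  rw [div_le_iff₀ h0] at lo
  set I := ∫ y in ulamBox N i, f y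
  rw [abs_le]
  constructor
  · linarith
  · have h3 : f x ≤ E * (N * I) := by linarith
    by_contra hcon
    push Not at hcon
    nlinarith [mul_nonneg (sq_nonneg (E - 1)) hpos.le]

/-- For `f` integrable on `[0,1]` in the discrete Lipschitz cone `C_a`, the Ulam
projection satisfies `‖f − π_N f‖_{L¹([0,1])} ≤ (e^{a/N} − 1)·‖f‖_{L¹([0,1])}`. -/
theorem ulam_projection_L1_error (a : ℝ) (ha : 0 < a) (N : ℕ) (hN : 1 ≤ N)
    (f : ℝ → ℝ) (hf : IntegrableOn f (Set.Icc (0 : ℝ) 1)) (hfa : lipCone a f) :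
    (∫ x in Set.Icc (0 : ℝ) 1, |f x - ulamProj N f x|) ≤
      (Real.exp (a / N) - 1) * ∫ x in Set.Icc (0 : ℝ) 1, |f x| := by
  have h0 : (0 : ℝ) < N := by exact_mod_cast hN
  rw [← integral_const_mul]
  refine integral_mono_of_nonneg (Filter.Eventually.of_forall fun x => abs_nonneg _)
    (hf.abs.const_mul _) ?_
  filter_upwards [ae_restrict_mem measurableSet_Icc] with x hx
  exact ulam_pointwise a ha N hN f hf hfa hx
end

section
/- Let X be a measurable space, p a Markov kernel on X with Perron–Frobenius operator 𝒫, κ ∈ (0,1], and g : X → ℝ measurable with κ ≤ g(x) ≤ κ⁻¹ for all x. Then for any probability measures μ, μ′ and ν′ on X (ν′ playing the role of an approximation of 𝒫μ′), one has d(L_g ν′, L_g 𝒫μ) ≤ 2κ⁻²·( d(ν′, 𝒫μ′) + d(μ′, μ) ). -/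
open MeasureTheory ProbabilityTheory

lemma tv_key {X : Type*} [MeasurableSpace X] (μ ν : Measure X) [IsProbabilityMeasure μ]
    [IsProbabilityMeasure ν] (h : X → ℝ) (hm : Measurable h) (C : ℝ) (hC : 0 < C)
    (hb : ∀ x, |h x| ≤ C) :
    |(∫ x, h x ∂μ) - ∫ x, h x ∂ν| ≤ 2 * C * tvDist μ ν := by
  have key : (1 / 2) * |(∫ x, C⁻¹ * h x ∂μ) - ∫ x, C⁻¹ * h x ∂ν| ≤ tvDist μ ν := by
    apply le_csSup
    · refine ⟨1, ?_⟩
      rintro r ⟨f, -, hf, rfl⟩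
      have h1 : |∫ x, f x ∂μ| ≤ 1 := by
        have := norm_integral_le_of_norm_le_const (μ := μ) (f := f) (C := 1) (Filter.Eventually.of_forall hf)
        simpa using this
      have h2 : |∫ x, f x ∂ν| ≤ 1 := by
        have := norm_integral_le_of_norm_le_const (μ := ν) (f := f) (C := 1) (Filter.Eventually.of_forall hf)
        simpa using this
      have := abs_sub (∫ x, f x ∂μ) (∫ x, f x ∂ν)
      linarith
    · refine ⟨fun x => C⁻¹ * h x, hm.const_mul _, fun x => ?_, rfl⟩
      rw [abs_mul, abs_of_pos (inv_pos.2 hC), inv_mul_le_iff₀ hC]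
      simpa using hb x
  rw [integral_const_mul, integral_const_mul, ← mul_sub, abs_mul, abs_of_pos (inv_pos.2 hC)] at key
  have e : |(∫ x, h x ∂μ) - ∫ x, h x ∂ν|
      = 2 * C * ((1 / 2) * (C⁻¹ * |(∫ x, h x ∂μ) - ∫ x, h x ∂ν|)) := by
    field_simp
  rw [e]
  gcongr

lemma int_like {X : Type*} [MeasurableSpace X] (g : X → ℝ) (hg : Measurable g)
    (h0 : ∀ x, 0 ≤ g x) (μ : Measure X) (hi : Integrable g μ) (f : X → ℝ) :
    ∫ x, f x ∂(likelihoodOp g μ) = (∫ x, g x ∂μ)⁻¹ * ∫ x, f x * g x ∂μ := by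
  unfold likelihoodOp
  rw [integral_smul_measure, integral_withDensity_eq_integral_toReal_smul (by fun_prop) (by simp),
    withDensity_apply _ MeasurableSet.univ, Measure.restrict_univ,
    ← ofReal_integral_eq_lintegral_ofReal hi (Filter.Eventually.of_forall h0), ENNReal.toReal_inv,
    ENNReal.toReal_ofReal (integral_nonneg h0), smul_eq_mul]
  congr 1
  refine integral_congr_ae (Filter.Eventually.of_forall fun x => ?_)
  simp [ENNReal.toReal_ofReal (h0 x), mul_comm]

theorem filtering_one_step_error
    {X : Type*} [MeasurableSpace X] (p : Kernel X X) [IsMarkovKernel p]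
    (κ : ℝ) (hκ : κ ∈ Set.Ioc (0 : ℝ) 1)
    (g : X → ℝ) (hg : Measurable g) (hgb : ∀ x, κ ≤ g x ∧ g x ≤ κ⁻¹)
    (μ μ' ν' : Measure X) [IsProbabilityMeasure μ] [IsProbabilityMeasure μ']
    [IsProbabilityMeasure ν'] :
    tvDist (likelihoodOp g ν') (likelihoodOp g (μ.bind p)) ≤
      2 * κ⁻¹ ^ 2 * (tvDist ν' (μ'.bind p) + tvDist μ' μ) := by
  obtain ⟨hκ0, -⟩ := hκ
  have hC : 0 < κ⁻¹ := inv_pos.2 hκ0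
  have g0 : ∀ x, 0 ≤ g x := fun x => hκ0.le.trans (hgb x).1
  have gabs : ∀ x, |g x| ≤ κ⁻¹ := fun x => by rw [abs_of_nonneg (g0 x)]; exact (hgb x).2
  have gi : ∀ (m : Measure X) [IsProbabilityMeasure m], Integrable g m := fun m _ =>
    Integrable.of_bound hg.aestronglyMeasurable κ⁻¹ (Filter.Eventually.of_forall gabs)
  have bnd : ∀ h : X → ℝ, Measurable h → (∀ x, |h x| ≤ κ⁻¹) →
      |(∫ x, h x ∂ν') - ∫ x, h x ∂(μ.bind p)|
        ≤ 2 * κ⁻¹ * (tvDist ν' (μ'.bind p) + tvDist μ' μ) := by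
    intro h hm hb
    have e : ∀ (m : Measure X) [IsProbabilityMeasure m],
        ∫ x, h x ∂(m.bind p) = ∫ x, ∫ y, h y ∂(p x) ∂m := fun m _ => by
      rw [Measure.comp_eq_comp_const_apply, Kernel.integral_comp, Kernel.const_apply]
      exact Integrable.of_bound hm.aestronglyMeasurable κ⁻¹ (Filter.Eventually.of_forall hb)
    have h1 := tv_key ν' (μ'.bind p) h hm _ hC hb
    have h2 := tv_key μ' μ (fun x => ∫ y, h y ∂(p x))
      (hm.stronglyMeasurable.integral_kernel).measurable _ hC (fun x => by
        have := norm_integral_le_of_norm_le_const (μ := p x) (f := h) (C := κ⁻¹) (Filter.Eventually.of_forall hb)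
        simpa using this)
    rw [← e, ← e] at h2
    have := abs_sub_le (∫ x, h x ∂ν') (∫ x, h x ∂(μ'.bind p)) (∫ x, h x ∂(μ.bind p))
    linarith
  set η := μ.bind p with hη
  have : IsProbabilityMeasure η := by rw [hη]; infer_instance
  set T := tvDist ν' (μ'.bind p) + tvDist μ' μ
  have ge : ∀ (m : Measure X) [IsProbabilityMeasure m], κ ≤ ∫ x, g x ∂m := fun m _ => by
    have := integral_mono (integrable_const κ) (gi m) (fun x => (hgb x).1)
    simpa using this
  unfold tvDist
  refine csSup_le ⟨_, fun _ => 0, measurable_const, by simp, rfl⟩ ?_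
  rintro r ⟨f, fm, fb, rfl⟩
  rw [int_like g hg g0 _ (gi _), int_like g hg g0 _ (gi _)]
  have hfg : ∀ x, |f x * g x| ≤ g x := fun x => by
    rw [abs_mul, abs_of_nonneg (g0 x)]
    exact mul_le_of_le_one_left (g0 x) (fb x)
  have b1 := bnd g hg gabs
  have b2 := bnd (fun x => f x * g x) (fm.mul hg) (fun x => (hfg x).trans (hgb x).2)
  have b3 : |∫ x, f x * g x ∂η| ≤ ∫ x, g x ∂η :=
    norm_integral_le_of_norm_le (f := fun x => f x * g x) (gi η) (Filter.Eventually.of_forall hfg)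
  have ha := ge ν'
  have hb := ge η
  generalize (∫ x, g x ∂ν') = a at *
  generalize (∫ x, g x ∂η) = b at *
  generalize (∫ x, f x * g x ∂ν') = A at *
  generalize (∫ x, f x * g x ∂η) = B at *
  have a0 : 0 < a := hκ0.trans_le ha
  have b0 : 0 < b := hκ0.trans_le hb
  have e : a⁻¹ * A - b⁻¹ * B = a⁻¹ * ((A - B) - (B / b) * (a - b)) := by
    field_simp
    ring
  have q : |B / b| ≤ 1 := by rw [abs_div, abs_of_pos b0, div_le_one b0]; exact b3
  have q2 : |(A - B) - (B / b) * (a - b)| ≤ 4 * κ⁻¹ * T := by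
    have h1 := abs_sub (A - B) ((B / b) * (a - b))
    have h2 : |(B / b) * (a - b)| ≤ |a - b| := by
      rw [abs_mul]; exact mul_le_of_le_one_left (abs_nonneg _) q
    linarith
  rw [e, abs_mul, abs_of_pos (inv_pos.2 a0)]
  have q3 : a⁻¹ ≤ κ⁻¹ := inv_anti₀ hκ0 ha
  have := mul_le_mul q3 q2 (abs_nonneg _) hC.le
  linarith
end

section
/- Let X be a measurable space, p a Markov kernel on X with Perron–Frobenius operator 𝒫, κ ∈ (0,1], and measurable likelihood functions g_j : X → [κ, κ⁻¹] for j = 0,…,J−1. Define the exact filtering measures μ_{j+1} = L_{g_j} 𝒫 μ_j starting from a probability measure μ_0. Let m ≥ 1 and define, on a probability space, the SIR particle filter: μ^m_0 = μ_0; given μ^m_j, draw particles x̂^{(1)}_{j+1},…,x̂^{(m)}_{j+1} conditionally i.i.d. with law 𝒫μ^m_j (equivalently, resample x^{(n)}_j i.i.d. from μ^m_j and draw x̂^{(n)}_{j+1} ∼ p(x^{(n)}_j, ·) independently), and set μ^m_{j+1} = Σ_{n=1}^m ω^{(n)}_{j+1} δ_{x̂^{(n)}_{j+1}} with ω^{(n)}_{j+1}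 = g_j(x̂^{(n)}_{j+1}) / Σ_{l=1}^m g_j(x̂^{(l)}_{j+1}). Then, with the root-mean-square total-variation distance D(μ,ν) = sup{ (1/2)·(E|∫ f dμ − ∫ f dν|²)^{1/2} : f measurable, sup_x |f(x)| ≤ 1 } on random probability measures, D(μ^m_J, μ_J) ≤ Σ_{j=1}^J (2κ⁻²)^j · m^{-1/2}. -/
open MeasureTheory ProbabilityTheory

/-- The root-mean-square total-variation distance between two random measures:
`D(μ,ν) = sup{ (1/2)·(E|∫ f dμ − ∫ f dν|²)^{1/2} : f measurable, sup|f| ≤ 1 }`. -/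
noncomputable def rmsTvDist {Ω X : Type*} [MeasurableSpace Ω] [MeasurableSpace X]
    (P : Measure Ω) (μ ν : Ω → Measure X) : ℝ :=
  sSup {r : ℝ | ∃ f : X → ℝ, Measurable f ∧ (∀ x, |f x| ≤ 1) ∧
    r = (1 / 2) * Real.sqrt (∫ ω, |(∫ x, f x ∂(μ ω)) - ∫ x, f x ∂(ν ω)| ^ 2 ∂P)}

/-- The weighted empirical measure `Σ_{n=1}^m ω_n δ_{x_n}` with likelihood weights
`ω_n = g(x_n)/Σ_l g(x_l)`. -/
noncomputable def empMeas {X : Type*} [MeasurableSpace X] {m : ℕ}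
    (g : X → ℝ) (x : Fin m → X) : Measure X :=
  ∑ n, ENNReal.ofReal (g (x n) / ∑ l, g (x l)) • Measure.dirac (x n)

section Helpers

lemma aux_bdd_int {X : Type*} [MeasurableSpace X] (ν : Measure X) [IsFiniteMeasure ν] (f : X → ℝ)
    (hf : Measurable f) (C : ℝ) (hb : ∀ x, |f x| ≤ C) : Integrable f ν :=
  Integrable.of_bound hf.aestronglyMeasurable C (Filter.Eventually.of_forall hb)

lemma aux_integral_bind {X Y : Type*} [MeasurableSpace X] [MeasurableSpace Y] (ν : Measure X)
    (k : Kernel X Y) (f : Y → ℝ) (hf : Integrable f (ν.bind k)) :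
    ∫ y, f y ∂(ν.bind k) = ∫ x, ∫ y, f y ∂(k x) ∂ν := by
  rw [Measure.comp_eq_comp_const_apply] at hf ⊢
  rw [Kernel.integral_comp hf]
  simp

lemma aux_abs_int {X : Type*} [MeasurableSpace X] (ν : Measure X) [IsProbabilityMeasure ν]
    (f : X → ℝ) (C : ℝ) (hb : ∀ x, |f x| ≤ C) : |∫ x, f x ∂ν| ≤ C := by
  have := norm_integral_le_of_norm_le_const (μ := ν) (f := f) (C := C)
    (Filter.Eventually.of_forall hb)
  simpa using this

lemma aux_var {X : Type*} [MeasurableSpace X] (ν : Measure X) [IsProbabilityMeasure ν]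
    {m : ℕ} (hm : 1 ≤ m) (h : X → ℝ) (hh : Measurable h) (hb : ∀ x, |h x| ≤ 1) (c : ℝ) :
    ∫ x, ((∑ n, h (x n)) / m - c) ^ 2 ∂(Measure.pi fun _ : Fin m => ν) ≤
      1 / m + ((∫ x, h x ∂ν) - c) ^ 2 := by
  set Q := Measure.pi fun _ : Fin m => ν with hQ
  have hm0 : (0 : ℝ) < m := by exact_mod_cast hm
  have hL : MemLp h 2 ν := MemLp.of_bound hh.aestronglyMeasurable 1 (Filter.Eventually.of_forall hb)
  have hv := variance_sum_pi (μ := fun _ : Fin m => ν) (X := fun _ => h) (fun _ => hL)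
  have hLn : ∀ n : Fin m, MemLp (fun x : Fin m → X => h (x n)) 2 Q := fun n =>
    hL.comp_measurePreserving (measurePreserving_eval _ n)
  have hLS : MemLp (∑ n : Fin m, fun x : Fin m → X => h (x n)) 2 Q :=
    memLp_finsetSum' _ (fun n _ => hLn n)
  have hmean : ∀ n : Fin m, ∫ x, h (x n) ∂Q = ∫ x, h x ∂ν := fun n => by
    have := integral_map (μ := Q) (φ := fun x : Fin m → X => x n) (f := h)
      (measurable_pi_apply n).aemeasurable hh.aestronglyMeasurable
    rw [← this, (measurePreserving_eval _ n).map_eq]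
  have hS : ∫ x, (∑ n : Fin m, fun x : Fin m → X => h (x n)) x ∂Q = m * ∫ x, h x ∂ν := by
    simp only [Finset.sum_apply]
    rw [integral_finsetSum _ (fun n _ => (hLn n).integrable (by norm_num))]
    simp [hmean]
  have hvar1 : Var[h; ν] ≤ 1 := by
    have := variance_le_sq_of_bounded (μ := ν) (a := -1) (b := 1) (X := h)
      (Filter.Eventually.of_forall fun x => by simpa [abs_le] using hb x) hh.aemeasurable
    simpa using this.trans (by norm_num)
  rw [variance_eq_sub hLS, hS] at hv
  simp only [Finset.sum_const, Finset.card_univ, Fintype.card_fin, nsmul_eq_mul] at hv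
  have hsq : Integrable (fun x => (∑ n : Fin m, h (x n)) ^ 2) Q := by
    have := hLS.integrable_sq
    simpa using this
  have hsi : Integrable (fun x => (∑ n : Fin m, h (x n))) Q := by
    have := hLS.integrable (by norm_num)
    convert this using 2
    simp
  have hexp : ∫ x, ((∑ n, h (x n)) / m - c) ^ 2 ∂Q =
      (1 / m ^ 2) * ∫ x, (∑ n, h (x n)) ^ 2 ∂Q - (2 * c / m) * ∫ x, (∑ n, h (x n)) ∂Q + c ^ 2 := by
    rw [← integral_const_mul, ← integral_const_mul, ← integral_sub (hsq.const_mul _) (hsi.const_mul _)]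
    have : c ^ 2 = ∫ x, c ^ 2 ∂Q := by simp
    rw [this, ← integral_add (f := fun x : Fin m → X => 1 / (m : ℝ) ^ 2 * (∑ n, h (x n)) ^ 2 -
      2 * c / m * ∑ n, h (x n)) ((hsq.const_mul _).sub (hsi.const_mul _)) (integrable_const _)]
    congr 1; ext x; field_simp
    ring
  simp only [Finset.sum_apply, Pi.pow_apply] at hv hS
  rw [hexp, hS]
  have : ∫ x, (∑ n, h (x n)) ^ 2 ∂Q = m * Var[h; ν] + (m * ∫ x, h x ∂ν) ^ 2 := by linarith
  rw [this]
  have e : 1 / (m:ℝ) ^ 2 * (m * Var[h; ν] + (m * ∫ x, h x ∂ν) ^ 2) -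
      2 * c / m * (m * ∫ x, h x ∂ν) + c ^ 2 = Var[h; ν] / m + ((∫ x, h x ∂ν) - c) ^ 2 := by
    field_simp; ring
  rw [e]
  gcongr

lemma aux_meas_pi {Ω X : Type*} [MeasurableSpace Ω] [MeasurableSpace X] {m : ℕ}
    (ν : Ω → Measure X) [∀ ω, IsProbabilityMeasure (ν ω)] (hν : Measurable ν) :
    Measurable fun ω => Measure.pi fun _ : Fin m => ν ω := by
  refine Measurable.measure_of_isPiSystem_of_isProbabilityMeasure
    (S := Set.pi Set.univ '' Set.pi Set.univ fun _ : Fin m => {s : Set X | MeasurableSet s})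
    generateFrom_pi.symm isPiSystem_pi ?_
  rintro _ ⟨s, hs, rfl⟩
  simp only [Measure.pi_pi]
  exact Finset.measurable_prod _ fun i _ => (Measure.measurable_coe (hs i trivial)).comp hν

lemma aux_meas_emp {X : Type*} [MeasurableSpace X] {m : ℕ} (g : X → ℝ) (hg : Measurable g) :
    Measurable fun x : Fin m → X => empMeas g x := by
  refine Measure.measurable_of_measurable_coe _ fun s hs => ?_
  unfold empMeas
  simp only [Measure.coe_finset_sum, Finset.sum_apply, Measure.smul_apply, smul_eq_mul]
  refine Finset.measurable_sum _ fun n _ => Measurable.mul ?_ ?_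
  · fun_prop
  · exact (Measure.measurable_coe hs).comp (Measure.measurable_dirac.comp (measurable_pi_apply n))

lemma aux_sum_pos {X : Type*} {m : ℕ} (hm : 1 ≤ m) (g : X → ℝ) (hg : ∀ x, 0 < g x)
    (x : Fin m → X) : 0 < ∑ l, g (x l) := by
  haveI : Nonempty (Fin m) := ⟨⟨0, hm⟩⟩
  exact Finset.sum_pos (fun i _ => hg _) Finset.univ_nonempty

lemma aux_emp_prob {X : Type*} [MeasurableSpace X] {m : ℕ} (hm : 1 ≤ m) (g : X → ℝ)
    (hg : ∀ x, 0 < g x) (x : Fin m → X) : IsProbabilityMeasure (empMeas g x) := by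
  have hs := aux_sum_pos hm g hg x
  constructor
  unfold empMeas
  simp only [Measure.coe_finset_sum, Finset.sum_apply, Measure.smul_apply, smul_eq_mul,
    measure_univ, mul_one]
  rw [← ENNReal.ofReal_sum_of_nonneg (fun i _ => (div_pos (hg _) hs).le), ← Finset.sum_div,
    div_self hs.ne', ENNReal.ofReal_one]

lemma aux_emp_int {X : Type*} [MeasurableSpace X] {m : ℕ} (hm : 1 ≤ m) (g : X → ℝ)
    (hg : ∀ x, 0 < g x) (x : Fin m → X) (f : X → ℝ) (hf : Measurable f) :
    ∫ y, f y ∂(empMeas g x) = (∑ n, g (x n) * f (x n)) / ∑ l, g (x l) := by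
  have hs := aux_sum_pos hm g hg x
  unfold empMeas
  rw [integral_finset_sum_measure]
  · rw [Finset.sum_div]
    refine Finset.sum_congr rfl fun n _ => ?_
    rw [integral_smul_measure, integral_dirac' _ _ hf.stronglyMeasurable,
      ENNReal.toReal_ofReal (div_pos (hg _) hs).le, smul_eq_mul]
    ring
  · intro n _
    refine Integrable.smul_measure ?_ ENNReal.ofReal_ne_top
    exact integrable_dirac' hf.stronglyMeasurable (by simp)

lemma aux_like {X : Type*} [MeasurableSpace X] (g : X → ℝ) (hg : Measurable g)
    (κ : ℝ) (hκ : 0 < κ) (hgb : ∀ x, κ ≤ g x ∧ g x ≤ κ⁻¹) (ν : Measure X) [IsProbabilityMeasure ν] :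
    IsProbabilityMeasure (likelihoodOp g ν) ∧ κ ≤ ∫ x, g x ∂ν ∧ ∀ f : X → ℝ,
      ∫ x, f x ∂(likelihoodOp g ν) = (∫ x, g x * f x ∂ν) / ∫ x, g x ∂ν := by
  have hgi : Integrable g ν := aux_bdd_int ν g hg κ⁻¹ fun x => by
    rw [abs_of_pos (hκ.trans_le (hgb x).1)]; exact (hgb x).2
  have h1 : κ ≤ ∫ x, g x ∂ν := by
    have := integral_mono (μ := ν) (integrable_const κ) hgi (fun x => (hgb x).1)
    simpa using this
  have hZ : (ν.withDensity fun x => ENNReal.ofReal (g x)) Set.univ =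
      ENNReal.ofReal (∫ x, g x ∂ν) := by
    rw [withDensity_apply _ MeasurableSet.univ, Measure.restrict_univ,
      ofReal_integral_eq_lintegral_ofReal hgi
        (Filter.Eventually.of_forall fun x => hκ.le.trans (hgb x).1)]
  have hpos : 0 < ∫ x, g x ∂ν := hκ.trans_le h1
  refine ⟨⟨?_⟩, h1, fun f => ?_⟩
  · unfold likelihoodOp
    rw [Measure.smul_apply, smul_eq_mul, hZ]
    exact ENNReal.inv_mul_cancel (by simpa using hpos) ENNReal.ofReal_ne_top
  · unfold likelihoodOp
    rw [integral_smul_measure, hZ, integral_withDensity_eq_integral_toReal_smul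
      (by fun_prop) (by simp)]
    simp only [smul_eq_mul, ENNReal.toReal_inv]
    rw [ENNReal.toReal_ofReal hpos.le, div_eq_inv_mul]
    congr 2; ext x
    rw [ENNReal.toReal_ofReal (hκ.le.trans (hgb x).1)]

/-- Deterministic ratio bound. -/
lemma aux_ratio (κ a b c d t : ℝ) (hκ : 0 < κ) (hb : 0 < b) (hd : κ ≤ d)
    (hab : |a / b| ≤ 1) (ht : κ * t = 1) :
    |a / b - c / d| ^ 2 ≤ 2 * t ^ 2 * ((a - c) ^ 2 + (b - d) ^ 2) := by
  have hd0 : 0 < d := hκ.trans_le hd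
  have e : a / b - c / d = ((a - c) + (a / b) * (d - b)) / d := by field_simp; ring
  have h2 : ((a / b) * (d - b)) ^ 2 ≤ (b - d) ^ 2 := by
    rw [mul_pow, ← sq_abs (a / b)]
    have : |a / b| ^ 2 ≤ 1 := by nlinarith [abs_nonneg (a / b)]
    nlinarith [sq_nonneg (d - b)]
  have h3 : ((a - c) + (a / b) * (d - b)) ^ 2 ≤ 2 * ((a - c) ^ 2 + (b - d) ^ 2) := by
    nlinarith [sq_nonneg ((a - c) - (a / b) * (d - b))]
  rw [sq_abs, e, div_pow, div_le_iff₀ (by positivity)]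
  have h4 : 1 ≤ t ^ 2 * d ^ 2 := by
    have htp : 0 < t := by
      by_contra hn
      nlinarith
    have : 1 ≤ t * d := by nlinarith
    nlinarith
  calc _ ≤ 2 * ((a - c) ^ 2 + (b - d) ^ 2) := h3
    _ ≤ (t ^ 2 * d ^ 2) * (2 * ((a - c) ^ 2 + (b - d) ^ 2)) := by
        have : 0 ≤ 2 * ((a - c) ^ 2 + (b - d) ^ 2) := by positivity
        nlinarith
    _ = _ := by ring

/-- One step for the sampling part. -/
lemma aux_sample {X Ω : Type*} [MeasurableSpace X] [MeasurableSpace Ω]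
    (Pr : Measure Ω) [IsProbabilityMeasure Pr] {m : ℕ} (hm : 1 ≤ m)
    (ν : Ω → Measure X) [∀ ω, IsProbabilityMeasure (ν ω)] (hν : Measurable ν)
    (ξ : Ω → Fin m → X) (hξ : Measurable ξ)
    (hlaw : ∀ A, MeasurableSet A → Pr (ξ ⁻¹' A) =
      ∫⁻ ω, (Measure.pi fun _ : Fin m => ν ω) A ∂Pr)
    (h : X → ℝ) (hh : Measurable h) (hb : ∀ x, |h x| ≤ 1) (c : ℝ) (hc : |c| ≤ 1) :
    ∫ ω, ((∑ n, h (ξ ω n)) / m - c) ^ 2 ∂Pr ≤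
      1 / m + ∫ ω, ((∫ x, h x ∂(ν ω)) - c) ^ 2 ∂Pr := by
  have hm0 : (0 : ℝ) < m := by exact_mod_cast hm
  let K : Kernel Ω (Fin m → X) := ⟨fun ω => Measure.pi fun _ : Fin m => ν ω, aux_meas_pi ν hν⟩
  have hK : ∀ ω, K ω = Measure.pi fun _ : Fin m => ν ω := fun ω => rfl
  haveI : IsMarkovKernel K := ⟨fun ω => by rw [hK]; infer_instance⟩
  have hmap : Pr.map ξ = Pr.bind K := by
    ext A hA
    rw [Measure.map_apply hξ hA, Measure.bind_apply hA K.aemeasurable, hlaw A hA]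
    rfl
  let F : (Fin m → X) → ℝ := fun x => ((∑ n, h (x n)) / m - c) ^ 2
  have hF : Measurable F := by fun_prop
  have hFb : ∀ x, |F x| ≤ 4 := fun x => by
    have h1 : |(∑ n, h (x n)) / m| ≤ 1 := by
      rw [abs_div, Nat.abs_cast, div_le_one hm0]
      calc _ ≤ ∑ n, |h (x n)| := Finset.abs_sum_le_sum_abs _ _
        _ ≤ ∑ n : Fin m, (1 : ℝ) := Finset.sum_le_sum fun n _ => hb _
        _ = m := by simp
    rw [abs_of_nonneg (sq_nonneg _)]
    have h2 := abs_le.1 h1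
    have h3 := abs_le.1 hc
    have : |(∑ n, h (x n)) / m - c| ≤ 2 := by rw [abs_le]; constructor <;> linarith
    calc _ = |(∑ n, h (x n)) / m - c| ^ 2 := (sq_abs _).symm
      _ ≤ 2 ^ 2 := by gcongr
      _ = 4 := by norm_num
  have hmh : Measurable fun ω => ∫ x, h x ∂(ν ω) := by
    let N : Kernel Ω X := ⟨ν, hν⟩
    have : Measurable fun ω => ∫ x, h x ∂(N ω) :=
      (hh.stronglyMeasurable.integral_kernel (κ := N)).measurable
    exact this
  have hi : Integrable (fun ω => ((∫ x, h x ∂(ν ω)) - c) ^ 2) Pr := by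
    refine aux_bdd_int Pr _ (by fun_prop) 4 fun ω => ?_
    have h2 := abs_le.1 (aux_abs_int (ν ω) h 1 hb)
    have h3 := abs_le.1 hc
    rw [abs_of_nonneg (sq_nonneg _)]
    nlinarith
  calc ∫ ω, ((∑ n, h (ξ ω n)) / m - c) ^ 2 ∂Pr = ∫ x, F x ∂(Pr.map ξ) :=
        (integral_map hξ.aemeasurable hF.aestronglyMeasurable).symm
    _ = ∫ ω, ∫ x, F x ∂(K ω) ∂Pr := by
        rw [hmap]; exact aux_integral_bind _ _ _ (aux_bdd_int _ F hF 4 hFb)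
    _ ≤ ∫ ω, (1 / m + ((∫ x, h x ∂(ν ω)) - c) ^ 2) ∂Pr := by
        refine integral_mono ?_ ((integrable_const _).add hi) fun ω => aux_var (ν ω) hm h hh hb c
        exact aux_bdd_int Pr _ ((hF.stronglyMeasurable.integral_kernel (κ := K)).measurable) 4
          fun ω => aux_abs_int _ F 4 hFb
    _ = _ := by rw [integral_add (integrable_const _) hi]; simp

end Helpers

/-- Convergence of the SIR particle filter: with exact filter `μ_{j+1} = L_{g_j} 𝒫 μ_j`,
particle vectors `ξ_{j+1}` drawn conditionally i.i.d. from `𝒫 μ^m_j` (encoded through the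
joint law of `(ξ_j, ξ_{j+1})`), and particle approximations
`μ^m_{j+1} = Σ_n ω^{(n)}_{j+1} δ_{ξ^{(n)}_{j+1}}`, one has
`D(μ^m_J, μ_J) ≤ Σ_{j=1}^J (2κ⁻²)^j·m^{-1/2}`. -/
theorem sir_particle_filter_error
    {X : Type*} [MeasurableSpace X] (p : Kernel X X) [IsMarkovKernel p]
    (κ : ℝ) (hκ : κ ∈ Set.Ioc (0 : ℝ) 1) (J : ℕ) (hJ : 1 ≤ J)
    (g : ℕ → X → ℝ) (hg : ∀ j, Measurable (g j))
    (hgb : ∀ j x, κ ≤ g j x ∧ g j x ≤ κ⁻¹)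
    (μ0 : Measure X) [IsProbabilityMeasure μ0]
    (μ : ℕ → Measure X) (hμ0 : μ 0 = μ0)
    (hμ : ∀ j, μ (j + 1) = likelihoodOp (g j) ((μ j).bind p))
    (m : ℕ) (hm : 1 ≤ m)
    {Ω : Type*} [MeasurableSpace Ω] (Pr : Measure Ω) [IsProbabilityMeasure Pr]
    (ξ : ℕ → Ω → (Fin m → X)) (hξ : ∀ j, Measurable (ξ j))
    (μm : ℕ → Ω → Measure X)
    (hμm0 : ∀ ω, μm 0 ω = μ0)
    (hμm : ∀ j ω, μm (j + 1) ω = empMeas (g j) (ξ (j + 1) ω))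
    (hstep : ∀ (j : ℕ) (Bset A : Set (Fin m → X)), MeasurableSet Bset → MeasurableSet A →
      Pr (ξ j ⁻¹' Bset ∩ ξ (j + 1) ⁻¹' A) =
        ∫⁻ ω in ξ j ⁻¹' Bset, (Measure.pi fun _ : Fin m => (μm j ω).bind p) A ∂Pr) :
    rmsTvDist Pr (μm J) (fun _ => μ J) ≤
      ∑ j ∈ Finset.Icc 1 J, (2 * κ⁻¹ ^ 2) ^ j * (1 / Real.sqrt m) := by
  obtain ⟨hκ0, hκ1⟩ := hκ
  have hm0 : (0 : ℝ) < m := by exact_mod_cast hm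
  set t := κ⁻¹ with ht
  have hκt : κ * t = 1 := mul_inv_cancel₀ hκ0.ne'
  have ht0 : 0 < t := inv_pos.2 hκ0
  have hgpos : ∀ j x, 0 < g j x := fun j x => hκ0.trans_le (hgb j x).1
  have hprob : ∀ j ω, IsProbabilityMeasure (μm j ω) := by
    intro j ω
    cases j with
    | zero => rw [hμm0]; infer_instance
    | succ j => rw [hμm]; exact aux_emp_prob hm _ (hgpos j) _
  have hmeas : ∀ j, Measurable (μm j) := by
    intro j
    cases j with
    | zero => rw [show μm 0 = fun _ => μ0 from funext hμm0]; exact measurable_const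
    | succ j =>
      rw [show μm (j + 1) = fun ω => empMeas (g j) (ξ (j + 1) ω) from funext (hμm j)]
      exact (aux_meas_emp (g j) (hg j)).comp (hξ (j + 1))
  have hprobμ : ∀ j, IsProbabilityMeasure (μ j) := by
    intro j
    induction j with
    | zero => rw [hμ0]; infer_instance
    | succ j ih => rw [hμ]; exact (aux_like (g j) (hg j) κ hκ0 (hgb j) _).1
  have key : ∀ j, ∀ f : X → ℝ, Measurable f → (∀ x, |f x| ≤ 1) →
      ∫ ω, |(∫ x, f x ∂(μm j ω)) - ∫ x, f x ∂(μ j)| ^ 2 ∂Pr ≤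
        ∑ i ∈ Finset.Icc 1 j, ((2 * t ^ 2) ^ 2) ^ i * (1 / m) := by
    intro j
    induction j with
    | zero => intro f _ _; simp [hμm0, hμ0]
    | succ j ih =>
      set e := ∑ i ∈ Finset.Icc 1 j, ((2 * t ^ 2) ^ 2) ^ i * (1 / (m : ℝ)) with he
      have hsamp : ∀ h : X → ℝ, Measurable h → (∀ x, |h x| ≤ 1) →
          ∫ ω, ((∑ n, h (ξ (j + 1) ω n)) / m - ∫ x, h x ∂((μ j).bind p)) ^ 2 ∂Pr ≤ 1 / m + e := by
        intro h hh hb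
        have h1 := aux_sample Pr hm (fun ω => (μm j ω).bind p)
          ((Measure.measurable_bind' p.measurable).comp (hmeas j)) (ξ (j + 1)) (hξ (j + 1))
          (fun A hA => by simpa using hstep j Set.univ A MeasurableSet.univ hA) h hh hb
          (∫ x, h x ∂((μ j).bind p)) (aux_abs_int _ h 1 hb)
        refine h1.trans (by
          gcongr
          have h2 := ih (fun x => ∫ y, h y ∂(p x))
            (hh.stronglyMeasurable.integral_kernel (κ := p)).measurable
            (fun x => aux_abs_int _ h 1 hb)
          rw [aux_integral_bind _ _ _ (aux_bdd_int _ h hh 1 hb)]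
          refine le_trans (le_of_eq ?_) h2
          congr 1; ext ω
          rw [aux_integral_bind _ _ _ (aux_bdd_int _ h hh 1 hb), sq_abs])
      have hscale : ∀ h : X → ℝ, Measurable h → (∀ x, |h x| ≤ t) →
          ∫ ω, ((∑ n, h (ξ (j + 1) ω n)) / m - ∫ x, h x ∂((μ j).bind p)) ^ 2 ∂Pr
            ≤ t ^ 2 * (1 / m + e) := by
        intro h hh hb
        have h1 := hsamp (fun x => κ * h x) (by fun_prop) (fun x => by
          rw [abs_mul, abs_of_pos hκ0, ← hκt]; gcongr; exact hb x)
        have h2 : ∀ ω, ((∑ n, κ * h (ξ (j + 1) ω n)) / m - ∫ x, κ * h x ∂((μ j).bind p)) ^ 2 =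
            κ ^ 2 * ((∑ n, h (ξ (j + 1) ω n)) / m - ∫ x, h x ∂((μ j).bind p)) ^ 2 := fun ω => by
          rw [integral_const_mul, ← Finset.mul_sum]; ring
        simp_rw [h2] at h1
        rw [integral_const_mul] at h1
        calc _ = t ^ 2 * (κ ^ 2 * ∫ ω, ((∑ n, h (ξ (j + 1) ω n)) / m -
              ∫ x, h x ∂((μ j).bind p)) ^ 2 ∂Pr) := by
              rw [← mul_assoc, ← mul_pow, mul_comm t, hκt]; ring
          _ ≤ _ := by gcongr
      intro f hf hfb
      have hgt : ∀ x, |g j x| ≤ t := fun x => by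
        rw [abs_of_pos (hgpos j x)]; exact (hgb j x).2
      have hgft : ∀ x, |g j x * f x| ≤ t := fun x => by
        rw [abs_mul]
        nlinarith [hgt x, hfb x, abs_nonneg (g j x), abs_nonneg (f x)]
      have hA := hscale (fun x => g j x * f x) ((hg j).mul hf) hgft
      have hB := hscale (g j) (hg j) hgt
      obtain ⟨-, hZ, hint⟩ := aux_like (g j) (hg j) κ hκ0 (hgb j) ((μ j).bind p)
      have hint_sq : ∀ h : X → ℝ, Measurable h → (∀ x, |h x| ≤ t) →
          Integrable (fun ω => ((∑ n, h (ξ (j + 1) ω n)) / m -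
            ∫ x, h x ∂((μ j).bind p)) ^ 2) Pr := by
        intro h hh hb
        refine aux_bdd_int Pr _ ?_ ((2 * t) ^ 2) fun ω => ?_
        · have h1 : ∀ n : Fin m, Measurable fun ω => ξ (j + 1) ω n :=
            fun n => (measurable_pi_apply n).comp (hξ (j + 1))
          fun_prop
        · have h1 : |(∑ n, h (ξ (j + 1) ω n)) / m| ≤ t := by
            rw [abs_div, Nat.abs_cast, div_le_iff₀ hm0]
            calc _ ≤ ∑ n, |h (ξ (j + 1) ω n)| := Finset.abs_sum_le_sum_abs _ _
              _ ≤ ∑ n : Fin m, t := Finset.sum_le_sum fun n _ => hb _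
              _ = t * m := by simp [mul_comm]
          have h2 := aux_abs_int ((μ j).bind p) h t hb
          rw [abs_pow]
          gcongr
          rw [abs_le] at *
          constructor <;> linarith [h1.1, h1.2, h2.1, h2.2]
      have hiA := hint_sq (fun x => g j x * f x) ((hg j).mul hf) hgft
      have hiB := hint_sq (g j) (hg j) hgt
      calc ∫ ω, |(∫ x, f x ∂(μm (j + 1) ω)) - ∫ x, f x ∂(μ (j + 1))| ^ 2 ∂Pr
          ≤ ∫ ω, 2 * t ^ 2 * (((∑ n, g j (ξ (j + 1) ω n) * f (ξ (j + 1) ω n)) / m -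
              ∫ x, g j x * f x ∂((μ j).bind p)) ^ 2 + ((∑ n, g j (ξ (j + 1) ω n)) / m -
              ∫ x, g j x ∂((μ j).bind p)) ^ 2) ∂Pr := by
            refine integral_mono_of_nonneg (Filter.Eventually.of_forall fun ω => by positivity)
              ((hiA.add hiB).const_mul _) (Filter.Eventually.of_forall fun ω => ?_)
            have hs := aux_sum_pos hm (g j) (hgpos j) (ξ (j + 1) ω)
            have e1 : ∫ x, f x ∂(μm (j + 1) ω) =
                ((∑ n, g j (ξ (j + 1) ω n) * f (ξ (j + 1) ω n)) / m) /
                  ((∑ n, g j (ξ (j + 1) ω n)) / m) := by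
              rw [hμm, aux_emp_int hm _ (hgpos j) _ f hf, div_div_div_cancel_right₀ hm0.ne']
            have e2 := aux_abs_int (μm (j + 1) ω) f 1 hfb
            beta_reduce
            rw [hμ j, hint f, e1]
            rw [e1] at e2
            exact aux_ratio κ _ _ _ _ t hκ0 (by positivity) hZ e2 hκt
        _ ≤ 2 * t ^ 2 * (t ^ 2 * (1 / m + e) + t ^ 2 * (1 / m + e)) := by
            rw [integral_const_mul, integral_add hiA hiB]
            gcongr
        _ = (2 * t ^ 2) ^ 2 * (1 / m) + (2 * t ^ 2) ^ 2 * e := by ring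
        _ = _ := by
            rw [he, Finset.mul_sum, ← Finset.add_sum_Ioc_eq_sum_Icc (by omega : 1 ≤ j + 1), pow_one]
            congr 1
            rw [show Finset.Ioc 1 (j + 1) = (Finset.Icc 1 j).map (addRightEmbedding 1) by
              rw [Finset.map_add_right_Icc]; rfl]
            rw [Finset.sum_map]
            refine Finset.sum_congr rfl fun i _ => ?_
            simp only [addRightEmbedding_apply]
            ring
  have hS0 : 0 ≤ ∑ j ∈ Finset.Icc 1 J, (2 * t ^ 2) ^ j * (1 / Real.sqrt m) :=
    Finset.sum_nonneg fun i _ => by positivity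
  refine Real.sSup_le ?_ hS0
  rintro r ⟨f, hf, hfb, rfl⟩
  have h1 : Real.sqrt (∫ ω, |(∫ x, f x ∂(μm J ω)) - ∫ x, f x ∂(μ J)| ^ 2 ∂Pr) ≤
      ∑ j ∈ Finset.Icc 1 J, (2 * t ^ 2) ^ j * (1 / Real.sqrt m) := by
    refine Real.sqrt_le_iff.2 ⟨hS0, (key J f hf hfb).trans ?_⟩
    refine le_trans (le_of_eq ?_) (Finset.sum_sq_le_sq_sum_of_nonneg (fun i _ => by positivity))
    refine Finset.sum_congr rfl fun i _ => ?_
    rw [mul_pow _ (1 / Real.sqrt m), div_pow, Real.sq_sqrt hm0.le, one_pow,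
      ← pow_mul, ← pow_mul, mul_comm 2 i]
  have h2 := Real.sqrt_nonneg (∫ ω, |(∫ x, f x ∂(μm J ω)) - ∫ x, f x ∂(μ J)| ^ 2 ∂Pr)
  linarith
end

section
/- Let Δ > 0, P > 0, and m, x₀ ∈ ℝ (with cosh(x₀) used only as a normalization). Then for every x ∈ ℝ, ∫_ℝ (1/√(2πΔ)) · (cosh(x)/cosh(y)) · e^{-Δ/2} · e^{-(x−y)²/(2Δ)} · cosh(y) · e^{-(y−m)²/(2P)} dy = e^{-Δ/2} · √(P/(P+Δ)) · cosh(x) · e^{-(x−m)²/(2(P+Δ))}. In particular, if the filtering density at one step is proportional to cosh(x)·exp(−(x−m)²/(2P)), then after propagation through the Beneš transition density p(x|y) = (1/√(2πΔ))·(cosh(x)/cosh(y))·e^{-Δ/2}·e^{-(x−y)²/(2Δ)} the predictive density is proportional to cosh(x)·exp(−(x−m)²/(2(P+Δ))). -/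
open Real

/-- Chapman–Kolmogorov prediction step for the Beneš filter: propagating the density
`cosh(y)·exp(−(y−m)²/(2P))` through the Beneš transition density
`p(x|y) = (1/√(2πΔ))·(cosh x/cosh y)·e^{−Δ/2}·e^{−(x−y)²/(2Δ)}` yields
`e^{−Δ/2}·√(P/(P+Δ))·cosh(x)·exp(−(x−m)²/(2(P+Δ)))`. -/
theorem benes_prediction_step (Δ P : ℝ) (hΔ : 0 < Δ) (hP : 0 < P) (m x₀ : ℝ) :
    ∀ x : ℝ,
      (∫ y : ℝ, (1 / Real.sqrt (2 * π * Δ)) * (Real.cosh x / Real.cosh y) *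
          Real.exp (-Δ / 2) * Real.exp (-(x - y) ^ 2 / (2 * Δ)) *
          (Real.cosh y * Real.exp (-(y - m) ^ 2 / (2 * P)))) =
        Real.exp (-Δ / 2) * Real.sqrt (P / (P + Δ)) * Real.cosh x *
          Real.exp (-(x - m) ^ 2 / (2 * (P + Δ))) := by
  intro x
  have hS : 0 < P + Δ := by positivity
  have hpt : ∀ y : ℝ, (1 / Real.sqrt (2 * π * Δ)) * (Real.cosh x / Real.cosh y) *
          Real.exp (-Δ / 2) * Real.exp (-(x - y) ^ 2 / (2 * Δ)) *
          (Real.cosh y * Real.exp (-(y - m) ^ 2 / (2 * P))) =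
      (1 / Real.sqrt (2 * π * Δ) * Real.cosh x * Real.exp (-Δ / 2) *
        Real.exp (-(x - m) ^ 2 / (2 * (P + Δ)))) *
        Real.exp (-((P + Δ) / (2 * P * Δ)) * (y - (P * x + Δ * m) / (P + Δ)) ^ 2) := by
    intro y
    have hc : Real.cosh y ≠ 0 := (Real.cosh_pos y).ne'
    have he : Real.exp (-(x - y) ^ 2 / (2 * Δ)) * Real.exp (-(y - m) ^ 2 / (2 * P)) =
        Real.exp (-(x - m) ^ 2 / (2 * (P + Δ))) *
        Real.exp (-((P + Δ) / (2 * P * Δ)) * (y - (P * x + Δ * m) / (P + Δ)) ^ 2) := by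
      rw [← Real.exp_add, ← Real.exp_add]
      congr 1
      field_simp
      ring
    calc _ = (1 / Real.sqrt (2 * π * Δ)) * Real.cosh x * (Real.cosh y / Real.cosh y) *
          Real.exp (-Δ / 2) * (Real.exp (-(x - y) ^ 2 / (2 * Δ)) *
          Real.exp (-(y - m) ^ 2 / (2 * P))) := by ring
      _ = _ := by rw [he, div_self hc]; ring
  simp_rw [hpt]
  rw [MeasureTheory.integral_const_mul,
    MeasureTheory.integral_sub_right_eq_self
      (fun y : ℝ => Real.exp (-((P + Δ) / (2 * P * Δ)) * y ^ 2)), integral_gaussian]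
  have hs : 1 / Real.sqrt (2 * π * Δ) * Real.sqrt (π / ((P + Δ) / (2 * P * Δ))) =
      Real.sqrt (P / (P + Δ)) := by
    rw [one_div_mul_eq_div, ← Real.sqrt_div' _ (by positivity)]
    congr 1
    have := Real.pi_pos
    field_simp
  rw [← hs]
  ring
end

section
/- Fix x₀ ∈ ℝ and define p : (0,∞) × ℝ → ℝ by p(t,x) = (1/√(2πt)) · (cosh(x)/cosh(x₀)) · exp(−t/2) · exp(−(x−x₀)²/(2t)). Then for every t > 0 and x ∈ ℝ, p satisfies the Fokker–Planck equation of the Beneš SDE: ∂p/∂t (t,x) = −∂/∂x ( tanh(x) · p(t,x) ) + (1/2) · ∂²p/∂x² (t,x). -/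
open Real

/-- The Beneš transition density
`p(t,x) = (1/√(2πt))·(cosh x/cosh x₀)·e^{−t/2}·e^{−(x−x₀)²/(2t)}` solves the
Fokker–Planck equation of the Beneš SDE `dx = tanh(x)dt + dW`:
`∂p/∂t = −∂/∂x(tanh(x)·p) + (1/2)·∂²p/∂x²`. -/
theorem benes_density_solves_fokker_planck (x₀ : ℝ) (p : ℝ → ℝ → ℝ)
    (hp : ∀ t x, p t x = (1 / Real.sqrt (2 * π * t)) * (Real.cosh x / Real.cosh x₀) *
      Real.exp (-t / 2) * Real.exp (-(x - x₀) ^ 2 / (2 * t))) :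
    ∀ t > (0 : ℝ), ∀ x : ℝ,
      deriv (fun s => p s x) t =
        -deriv (fun y => Real.tanh y * p t y) x + (1 / 2) * deriv (deriv (p t)) x := by
  intro t ht x
  have ht0 : t ≠ 0 := ht.ne'
  have hc0 : Real.cosh x₀ ≠ 0 := (Real.cosh_pos x₀).ne'
  obtain ⟨A, hA⟩ : ∃ A, A = 1 / Real.sqrt (2 * π * t) / Real.cosh x₀ * Real.exp (-t / 2) :=
    ⟨_, rfl⟩
  obtain ⟨E, hE⟩ : ∃ E : ℝ → ℝ, E = fun y => Real.exp (-(y - x₀) ^ 2 / (2 * t)) := ⟨_, rfl⟩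
  have hEd : ∀ y, HasDerivAt E (E y * (-(y - x₀) / t)) y := by
    intro y
    have h : HasDerivAt (fun y => Real.exp (-(y - x₀) ^ 2 / (2 * t)))
        (Real.exp (-(y - x₀) ^ 2 / (2 * t)) *
          (-(((2 : ℕ) : ℝ) * (y - x₀) ^ (2 - 1) * 1) / (2 * t))) y :=
      (((((hasDerivAt_id y).sub_const x₀).pow 2).neg).div_const (2 * t)).exp
    rw [hE]
    refine h.congr_deriv ?_
    congr 1
    norm_num
    field_simp
    ring
  have hpt : p t = fun y => A * (Real.cosh y * E y) := by
    funext y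
    rw [hp, hA, hE]
    ring
  have h1 : deriv (p t) = fun y =>
      A * (Real.sinh y * E y + Real.cosh y * (E y * (-(y - x₀) / t))) := by
    funext y
    rw [hpt]
    exact (((Real.hasDerivAt_cosh y).mul (hEd y)).const_mul A).deriv
  have hm : HasDerivAt (fun y => -(y - x₀) / t) (-1 / t) x :=
    (((hasDerivAt_id x).sub_const x₀).neg).div_const t
  have h2 : deriv (deriv (p t)) x =
      A * ((Real.cosh x * E x + Real.sinh x * (E x * (-(x - x₀) / t))) +
        (Real.sinh x * (E x * (-(x - x₀) / t)) + Real.cosh x *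
          (E x * (-(x - x₀) / t) * (-(x - x₀) / t) + E x * (-1 / t)))) := by
    rw [h1]
    exact ((((Real.hasDerivAt_sinh x).mul (hEd x)).add
      ((Real.hasDerivAt_cosh x).mul ((hEd x).mul hm))).const_mul A).deriv
  have h3 : deriv (fun y => Real.tanh y * p t y) x =
      A * (Real.cosh x * E x + Real.sinh x * (E x * (-(x - x₀) / t))) := by
    have : (fun y => Real.tanh y * p t y) = fun y => A * (Real.sinh y * E y) := by
      funext y
      have := (Real.cosh_pos y).ne'
      rw [hpt, Real.tanh_eq_sinh_div_cosh]
      field_simp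
    rw [this]
    exact (((Real.hasDerivAt_sinh x).mul (hEd x)).const_mul A).deriv
  have hpos : 0 < 2 * π * t := by positivity
  have hs0 : Real.sqrt (2 * π * t) ≠ 0 := (Real.sqrt_pos.2 hpos).ne'
  have hS : HasDerivAt (fun s => 1 / Real.sqrt (2 * π * s))
      (-(1 / (2 * t)) * (1 / Real.sqrt (2 * π * t))) t := by
    have h : HasDerivAt (fun s => (Real.sqrt (2 * π * s))⁻¹)
        (-(2 * π * 1 / (2 * Real.sqrt (2 * π * t))) / Real.sqrt (2 * π * t) ^ 2) t :=
      (((hasDerivAt_id t).const_mul (2 * π)).sqrt hpos.ne').inv hs0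
    simp only [one_div]
    refine h.congr_deriv ?_
    have hsq : Real.sqrt (2 * π * t) ^ 2 = 2 * π * t := Real.sq_sqrt hpos.le
    rw [hsq]
    field_simp
  have hX : HasDerivAt (fun s => Real.exp (-s / 2)) (Real.exp (-t / 2) * (-1 / 2)) t :=
    (((hasDerivAt_id t).neg).div_const 2).exp
  have hG : HasDerivAt (fun s => Real.exp (-(x - x₀) ^ 2 / (2 * s)))
      (E x * ((x - x₀) ^ 2 / (2 * t ^ 2))) t := by
    have h : HasDerivAt (fun s => Real.exp (-(x - x₀) ^ 2 / (2 * s)))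
        (Real.exp (-(x - x₀) ^ 2 / (2 * t)) *
          ((0 * (2 * t) - -(x - x₀) ^ 2 * (2 * 1)) / (2 * t) ^ 2)) t :=
      ((hasDerivAt_const t (-(x - x₀) ^ 2)).div
        ((hasDerivAt_id t).const_mul 2) (by simpa using ht0)).exp
    rw [hE]
    refine h.congr_deriv ?_
    congr 1
    field_simp
    ring
  have h4 : deriv (fun s => p s x) t = A * Real.cosh x * E x *
      (-(1 / (2 * t)) - 1 / 2 + (x - x₀) ^ 2 / (2 * t ^ 2)) := by
    have : (fun s => p s x) = fun s => (1 / Real.sqrt (2 * π * s)) *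
      (Real.cosh x / Real.cosh x₀) * Real.exp (-s / 2) *
      Real.exp (-(x - x₀) ^ 2 / (2 * s)) := funext fun s => hp s x
    rw [this]
    refine ((((hS.mul_const (Real.cosh x / Real.cosh x₀)).mul hX).mul hG).deriv).trans ?_
    have hEx : Real.exp (-(x - x₀) ^ 2 / (2 * t)) = E x := by rw [hE]
    simp only [Pi.mul_apply]
    rw [hEx, hA]
    ring
  rw [h4, h3, h2]
  field_simp
  ring
end
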